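/- For all integers n ≥ 0, A_{5,2}(25n + 23) ≡ 0 (mod 25). -/

import Mathlib

/-- Hook length of the cell in row `i`, column `j` (0-indexed) of the
Ferrers–Young diagram of the partition `p` (rows sorted in decreasing order). -/
def hookLength {n : ℕ} (p : n.Partition) (i j : ℕ) : ℕ :=
  (((p.parts.sort (· ≤ ·)).reverse.getD i 0 - j) +
    ((p.parts.filter (fun x => j < x)).card - i)) - 1

/-- A partition is a `t`-core if no hook number of its Ferrers–Young diagram is
divisible by `t`. -/
def IsTCore (t : ℕ) {n : ℕ} (p : n.Partition) : Prop :=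
  ∀ i j : ℕ, j < (p.parts.sort (· ≤ ·)).reverse.getD i 0 → ¬ t ∣ hookLength p i j

/-- `numA t k n` is the number of `k`-tuples of `t`-core partitions whose sizes sum to `n`. -/
noncomputable def numA (t k n : ℕ) : ℕ :=
  Nat.card { f : Fin k → Σ m : Fin (n + 1), Nat.Partition (m : ℕ) //
    (∑ i, ((f i).1 : ℕ)) = n ∧ ∀ i, IsTCore t (f i).2 }

open PowerSeries Finset

/-- The pairs of integers whose pentagonal numbers add up to `n`. -/
noncomputable def pentagonalPairs (n : ℕ) : Finset (ℤ × ℤ) :=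
  ((Icc (-(n : ℤ)) n) ×ˢ (Icc (-(n : ℤ)) n)).filter fun p => pentagonal p.1 + pentagonal p.2 = n

lemma abs_le_pentagonal (k : ℤ) : |k| ≤ pentagonal k := by
  have h := two_mul_natCast_pentagonal k
  rcases lt_trichotomy k 0 with hk | rfl | hk
  · rw [abs_of_neg hk]; nlinarith
  · simp
  · rw [abs_of_pos hk]; nlinarith

lemma mem_pentagonalPairs {n : ℕ} {p : ℤ × ℤ} :
    p ∈ pentagonalPairs n ↔ pentagonal p.1 + pentagonal p.2 = n := by
  simp only [pentagonalPairs, mem_filter, mem_product, mem_Icc, and_iff_right_iff_imp]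
  intro h
  have h1 := abs_le.1 (abs_le_pentagonal p.1)
  have h2 := abs_le.1 (abs_le_pentagonal p.2)
  lia

lemma coeff_pentagonalSeries_eq_sum {n N : ℕ} (h : n ≤ N) :
    coeff n (pentagonalSeries ℤ) =
      ∑ j ∈ Icc (-(N : ℤ)) N, if pentagonal j = n then (Int.negOnePow j : ℤ) else 0 := by
  by_cases hn : ∃ k, pentagonal k = n
  · obtain ⟨k, rfl⟩ := hn
    rw [coeff_pentagonalSeries_pentagonal, Finset.sum_eq_single k]
    · rw [if_pos rfl, Int.cast_id]
    · intro j _ hj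
      rw [if_neg (fun h => hj (pentagonal_injective h))]
    · intro hk
      have := abs_le.1 (abs_le_pentagonal k)
      exact absurd (mem_Icc.2 (by lia)) hk
  · rw [coeff_pentagonalSeries_eq_zero _ (by simpa using hn)]
    refine (Finset.sum_eq_zero fun j _ => if_neg fun h => hn ⟨j, h⟩).symm

lemma sum_antidiagonal_pentagonalSeries (α β : ℕ → ℤ) (n : ℕ) :
    ∑ p ∈ antidiagonal n, (α p.1 * coeff p.1 (pentagonalSeries ℤ)) *
        (β p.2 * coeff p.2 (pentagonalSeries ℤ)) =
      ∑ p ∈ pentagonalPairs n, α (pentagonal p.1) * β (pentagonal p.2) *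
        (Int.negOnePow (p.1 + p.2) : ℤ) := by
  have h1 : ∀ p ∈ antidiagonal n, (α p.1 * coeff p.1 (pentagonalSeries ℤ)) *
        (β p.2 * coeff p.2 (pentagonalSeries ℤ)) =
      ∑ q ∈ (Icc (-(n : ℤ)) n) ×ˢ (Icc (-(n : ℤ)) n),
        if pentagonal q.1 = p.1 ∧ pentagonal q.2 = p.2 then
          α (pentagonal q.1) * β (pentagonal q.2) * (Int.negOnePow (q.1 + q.2) : ℤ) else 0 := by
    intro p hp
    have hp' := mem_antidiagonal.1 hp
    rw [coeff_pentagonalSeries_eq_sum (show p.1 ≤ n by lia),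
      coeff_pentagonalSeries_eq_sum (show p.2 ≤ n by lia), mul_sum, mul_sum, sum_mul_sum,
      sum_product]
    refine sum_congr rfl fun j _ => sum_congr rfl fun k _ => ?_
    by_cases h1 : pentagonal j = p.1 <;> by_cases h2 : pentagonal k = p.2 <;>
      simp [h1, h2, Int.negOnePow_add]
    ring
  rw [sum_congr rfl h1, sum_comm, pentagonalPairs, sum_filter]
  refine sum_congr rfl fun q _ => ?_
  split_ifs with h
  · rw [Finset.sum_eq_single (pentagonal q.1, pentagonal q.2)]
    · simp
    · rintro ⟨x, y⟩ _ hne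
      refine if_neg ?_
      rintro ⟨rfl, rfl⟩
      exact hne rfl
    · intro h'
      exact absurd (mem_antidiagonal.2 h) h'
  · refine Finset.sum_eq_zero fun p hp => if_neg ?_
    rintro ⟨h1, h2⟩
    exact h (by rw [h1, h2]; exact mem_antidiagonal.1 hp)

/-- The involution `(j, k) ↦ (j - 2 * r, k - r)`, `5 * r = 4 * j + 2 * k - 1`, reverses signs. -/
lemma sum_pentagonalPairs_filter (n : ℕ) :
    ∑ p ∈ pentagonalPairs n with 5 ∣ 4 * p.1 + 2 * p.2 - 1, (Int.negOnePow (p.1 + p.2) : ℤ) = 0 := by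
  refine Finset.sum_involution
    (fun p _ => (p.1 - 2 * ((4 * p.1 + 2 * p.2 - 1) / 5), p.2 - (4 * p.1 + 2 * p.2 - 1) / 5))
    ?_ ?_ ?_ ?_
  · rintro ⟨j, k⟩ hp
    obtain ⟨r, hr⟩ := (mem_filter.1 hp).2
    simp only at hr ⊢
    rw [hr, Int.mul_ediv_cancel_left _ (by norm_num)]
    have : (j - 2 * r + (k - r)).negOnePow = - (j + k).negOnePow := by
      rw [show j - 2 * r + (k - r) = j + k - 3 * r by ring, Int.negOnePow_sub,
        Int.negOnePow_odd (3 * r) (by grind)]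
      simp
    rw [this]
    simp
  · rintro ⟨j, k⟩ hp _ heq
    obtain ⟨r, hr⟩ := (mem_filter.1 hp).2
    simp only [Prod.mk.injEq] at hr heq
    lia
  · rintro ⟨j, k⟩ hp
    obtain ⟨r, hr⟩ := (mem_filter.1 hp).2
    have hn := mem_pentagonalPairs.1 (mem_filter.1 hp).1
    simp only at hr hn
    simp only [mem_filter, mem_pentagonalPairs]
    rw [hr, Int.mul_ediv_cancel_left _ (by norm_num)]
    refine ⟨?_, ⟨-r, by linarith⟩⟩
    have h1 := two_mul_natCast_pentagonal j
    have h2 := two_mul_natCast_pentagonal k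
    have h3 := two_mul_natCast_pentagonal (j - 2 * r)
    have h4 := two_mul_natCast_pentagonal (k - r)
    have h5 : (2 * (pentagonal (j - 2 * r) : ℤ) + 2 * (pentagonal (k - r) : ℤ)) = 2 * n := by
      rw [← hn]
      push_cast
      linear_combination h3 + h4 - h1 - h2 - 3 * r * hr
    lia
  · rintro ⟨j, k⟩ hp
    obtain ⟨r, hr⟩ := (mem_filter.1 hp).2
    simp only [Prod.mk.injEq] at hr ⊢
    lia

/-- The part of Euler's product supported on exponents congruent to `i` mod `5`. -/
noncomputable def eulerPart (i : ℕ) : ℤ⟦X⟧ :=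
  mk fun n => (if n % 5 = i then 1 else 0) * coeff n (pentagonalSeries ℤ)

lemma pentagonal_mod_five (k : ℤ) :
    (k % 5 = 0 ∧ pentagonal k % 5 = 0) ∨ (k % 5 = 1 ∧ pentagonal k % 5 = 1) ∨
    (k % 5 = 2 ∧ pentagonal k % 5 = 0) ∨ (k % 5 = 3 ∧ pentagonal k % 5 = 2) ∨
    (k % 5 = 4 ∧ pentagonal k % 5 = 2) := by
  have h := two_mul_natCast_pentagonal k
  obtain ⟨m, i, hk, hi0, hi5⟩ : ∃ m i : ℤ, k = 5 * m + i ∧ 0 ≤ i ∧ i < 5 :=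
    ⟨k / 5, k % 5, by lia, by lia, by lia⟩
  subst hk
  have key : ∃ t : ℤ, 2 * (pentagonal (5 * m + i) : ℤ) = 5 * t + i * (3 * i - 1) :=
    ⟨m * (15 * m + 6 * i - 1), by rw [h]; ring⟩
  obtain ⟨t, ht⟩ := key
  interval_cases i <;> lia

lemma eulerPart_add : pentagonalSeries ℤ = eulerPart 0 + eulerPart 1 + eulerPart 2 := by
  ext n
  simp only [eulerPart, map_add, coeff_mk]
  by_cases hn : ∃ k, pentagonal k = n
  · obtain ⟨k, rfl⟩ := hn
    rcases pentagonal_mod_five k with h | h | h | h | h <;> simp [h.2]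
  · rw [coeff_pentagonalSeries_eq_zero _ (by simpa using hn)]
    simp

lemma eulerPart_zero_mul_two : eulerPart 0 * eulerPart 2 = - eulerPart 1 ^ 2 := by
  rw [eq_neg_iff_add_eq_zero]
  ext n
  rw [sq, map_add, coeff_mul, coeff_mul]
  simp only [eulerPart, coeff_mk, map_zero]
  rw [sum_antidiagonal_pentagonalSeries (fun x => if x % 5 = 0 then 1 else 0)
      (fun x => if x % 5 = 2 then 1 else 0),
    sum_antidiagonal_pentagonalSeries (fun x => if x % 5 = 1 then 1 else 0)
      (fun x => if x % 5 = 1 then 1 else 0), ← sum_add_distrib]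
  set z : ℤ × ℤ → ℤ := fun p => if p.1 % 5 = 4 ∧ p.2 % 5 = 0 ∨ p.1 % 5 = 3 ∧ p.2 % 5 = 2
    then (Int.negOnePow (p.1 + p.2) : ℤ) else 0 with hz
  set y : ℤ × ℤ → ℤ := fun p => if p.1 % 5 = 0 ∧ p.2 % 5 = 3 ∨ p.1 % 5 = 2 ∧ p.2 % 5 = 4 ∨
    p.1 % 5 = 1 ∧ p.2 % 5 = 1 then (Int.negOnePow (p.1 + p.2) : ℤ) else 0 with hy
  have hswap : ∑ p ∈ pentagonalPairs n, z p.swap = ∑ p ∈ pentagonalPairs n, z p := by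
    refine sum_nbij' Prod.swap Prod.swap ?_ ?_ (fun _ _ => rfl) (fun _ _ => rfl) (fun _ _ => rfl)
    all_goals
      intro p hp
      rw [mem_pentagonalPairs] at hp ⊢
      rw [← hp]
      exact add_comm _ _
  calc _ = ∑ p ∈ pentagonalPairs n, (y p + z p.swap) := by
        refine sum_congr rfl ?_
        rintro ⟨j, k⟩ _
        simp only [hz, hy, Prod.swap, add_comm k j]
        rcases pentagonal_mod_five j with h | h | h | h | h <;>
          rcases pentagonal_mod_five k with h' | h' | h' | h' | h' <;>
          simp [h.1, h.2, h'.1, h'.2]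
    _ = ∑ p ∈ pentagonalPairs n, (y p + z p) := by
        rw [sum_add_distrib, hswap, ← sum_add_distrib]
    _ = ∑ p ∈ pentagonalPairs n with 5 ∣ 4 * p.1 + 2 * p.2 - 1,
          (Int.negOnePow (p.1 + p.2) : ℤ) := by
        rw [sum_filter]
        refine sum_congr rfl ?_
        rintro ⟨j, k⟩ _
        simp only [hz, hy]
        have hdvd : 5 ∣ 4 * j + 2 * k - 1 ↔ (4 * (j % 5) + 2 * (k % 5)) % 5 = 1 := by lia
        rcases pentagonal_mod_five j with h | h | h | h | h <;>
          rcases pentagonal_mod_five k with h' | h' | h' | h' | h' <;>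
          simp [hdvd, h.1, h'.1]
    _ = 0 := sum_pentagonalPairs_filter n

/-- The substitution `q ↦ q ^ 5`. -/
noncomputable abbrev qFive : ℤ⟦X⟧ →ₐ[ℤ] ℤ⟦X⟧ := expand 5 (by norm_num)

lemma eulerPart_one : eulerPart 1 = - (X * qFive (qFive (pentagonalSeries ℤ))) := by
  have hpent (j : ℤ) : pentagonal (5 * j + 1) = 25 * pentagonal (-j) + 1 := by
    have h1 := two_mul_natCast_pentagonal (5 * j + 1)
    have h2 := two_mul_natCast_pentagonal (-j)
    zify
    linarith
  have hsign (j : ℤ) : ((5 * j + 1).negOnePow : ℤ) = - ((-j).negOnePow : ℤ) := by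
    have : (5 * j + 1).negOnePow = - (-j).negOnePow := by
      rw [show 5 * j + 1 = -j + (2 * (3 * j) + 1) by ring, Int.negOnePow_add,
        Int.negOnePow_odd (2 * (3 * j) + 1) (by simp)]
      simp
    rw [this]; simp
  ext n
  rw [map_neg]
  rcases n with _ | n
  · simp [eulerPart]
  rw [coeff_succ_X_mul]
  simp only [eulerPart, coeff_mk]
  by_cases h25 : 25 ∣ n
  · obtain ⟨m, rfl⟩ := h25
    rw [show 25 * m = 5 * (5 * m) by ring, coeff_expand_mul, coeff_expand_mul,
      if_pos (by lia), one_mul]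
    by_cases hm : ∃ k, pentagonal k = m
    · obtain ⟨k, rfl⟩ := hm
      have := hpent (-k)
      rw [neg_neg] at this
      rw [show 5 * (5 * pentagonal k) + 1 = pentagonal (5 * (-k) + 1) by lia,
        coeff_pentagonalSeries_pentagonal, coeff_pentagonalSeries_pentagonal]
      have := hsign (-k)
      rw [neg_neg] at this
      simpa only [Int.cast_id] using this
    · rw [coeff_pentagonalSeries_eq_zero _ (n := m) (by simpa using hm), neg_zero]
      refine coeff_pentagonalSeries_eq_zero _ ?_
      rintro ⟨k, hk⟩
      have hmod := pentagonal_mod_five k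
      obtain ⟨j, rfl⟩ : ∃ j, k = 5 * j + 1 := ⟨k / 5, by lia⟩
      exact hm ⟨-j, by have := hpent j; lia⟩
  · have hz : coeff n (qFive (qFive (pentagonalSeries ℤ))) = 0 := by
      by_cases h5 : 5 ∣ n
      · obtain ⟨m, rfl⟩ := h5
        rw [coeff_expand_mul, coeff_expand_of_not_dvd _ _ _ (by lia)]
      · rw [coeff_expand_of_not_dvd _ _ _ h5]
    rw [hz, neg_zero]
    split_ifs with h
    · rw [one_mul]
      refine coeff_pentagonalSeries_eq_zero _ ?_
      rintro ⟨k, hk⟩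
      have hmod := pentagonal_mod_five k
      obtain ⟨j, rfl⟩ : ∃ j, k = 5 * j + 1 := ⟨k / 5, by lia⟩
      have := hpent j
      lia
    · simp

/-- A power series supported on exponents congruent to `r` mod `5`. -/
def SupportedMod (r : ℕ) (f : ℤ⟦X⟧) : Prop := ∀ n, n % 5 ≠ r % 5 → coeff n f = 0

lemma SupportedMod.mul {r s : ℕ} {f g : ℤ⟦X⟧} (hf : SupportedMod r f) (hg : SupportedMod s g) :
    SupportedMod (r + s) (f * g) := by
  intro n hn
  rw [coeff_mul]
  refine Finset.sum_eq_zero fun p hp => ?_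
  have := mem_antidiagonal.1 hp
  by_cases h : p.1 % 5 = r % 5
  · rw [hg _ (by lia), mul_zero]
  · rw [hf _ h, zero_mul]

lemma SupportedMod.pow {r : ℕ} {f : ℤ⟦X⟧} (hf : SupportedMod r f) (k : ℕ) :
    SupportedMod (k * r) (f ^ k) := by
  induction k with
  | zero =>
    intro n hn
    rw [pow_zero, coeff_one, if_neg (by lia)]
  | succ k ih =>
    rw [pow_succ, add_mul, one_mul]
    exact ih.mul hf

lemma SupportedMod.add {r : ℕ} {f g : ℤ⟦X⟧} (hf : SupportedMod r f) (hg : SupportedMod r g) :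
    SupportedMod r (f + g) := by
  intro n hn
  rw [map_add, hf n hn, hg n hn, add_zero]

lemma SupportedMod.congr {r s : ℕ} {f : ℤ⟦X⟧} (hf : SupportedMod r f) (h : r % 5 = s % 5) :
    SupportedMod s f := fun n hn => hf n (by rwa [h])

lemma SupportedMod.const_mul {r : ℕ} {f : ℤ⟦X⟧} (hf : SupportedMod r f) (m : ℤ) :
    SupportedMod r ((m : ℤ⟦X⟧) * f) := by
  intro n hn
  rw [← zsmul_eq_mul, map_zsmul, hf n hn, smul_zero]

lemma supportedMod_qFive (f : ℤ⟦X⟧) : SupportedMod 0 (qFive f) := fun n hn =>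
  coeff_expand_of_not_dvd _ _ _ (by lia)

lemma supportedMod_eulerPart (i : ℕ) (hi : i < 5) : SupportedMod i (eulerPart i) := by
  intro n hn
  rw [eulerPart, coeff_mk, if_neg (by lia), zero_mul]

lemma euler_cube_dissection : ∃ f₀ f₁ f₂ f₄ : ℤ⟦X⟧, SupportedMod 0 f₀ ∧ SupportedMod 1 f₁ ∧
    SupportedMod 2 f₂ ∧ SupportedMod 4 f₄ ∧
    pentagonalSeries ℤ ^ 3 = f₀ + f₁ + f₂ - 5 * eulerPart 1 ^ 3 + f₄ := by
  have ha := supportedMod_eulerPart 0 (by norm_num)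
  have hb := supportedMod_eulerPart 1 (by norm_num)
  have hc := supportedMod_eulerPart 2 (by norm_num)
  have hac := eulerPart_zero_mul_two
  rw [eulerPart_add]
  set a := eulerPart 0
  set b := eulerPart 1
  set c := eulerPart 2
  refine ⟨a ^ 3 + (3 : ℤ) * (b * c ^ 2), (3 : ℤ) * (a ^ 2 * b) + c ^ 3,
    (3 : ℤ) * (a ^ 2 * c) + (3 : ℤ) * (a * b ^ 2),
    (3 : ℤ) * (a * c ^ 2) + (3 : ℤ) * (b ^ 2 * c), ?_, ?_, ?_, ?_, ?_⟩
  · exact ((ha.pow 3).congr (by norm_num)).add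
      ((((hb.mul (hc.pow 2))).congr (by norm_num)).const_mul 3)
  · exact ((((ha.pow 2).mul hb).congr (by norm_num)).const_mul 3).add
      ((hc.pow 3).congr (by norm_num))
  · exact ((((ha.pow 2).mul hc).congr (by norm_num)).const_mul 3).add
      (((ha.mul (hb.pow 2)).congr (by norm_num)).const_mul 3)
  · exact (((ha.mul (hc.pow 2)).congr (by norm_num)).const_mul 3).add
      ((((hb.pow 2).mul hc).congr (by norm_num)).const_mul 3)
  · push_cast
    linear_combination 6 * b * hac

lemma euler_pow_four_dissection : ∃ f₀ f₁ f₂ f₃ : ℤ⟦X⟧, SupportedMod 0 f₀ ∧ SupportedMod 1 f₁ ∧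
    SupportedMod 2 f₂ ∧ SupportedMod 3 f₃ ∧
    f₀ * f₃ + f₁ * f₂ = - 75 * eulerPart 1 ^ 8 ∧
    pentagonalSeries ℤ ^ 4 = f₀ + f₁ + f₂ + f₃ - 5 * eulerPart 1 ^ 4 := by
  have ha := supportedMod_eulerPart 0 (by norm_num)
  have hb := supportedMod_eulerPart 1 (by norm_num)
  have hc := supportedMod_eulerPart 2 (by norm_num)
  have hac := eulerPart_zero_mul_two
  rw [eulerPart_add]
  set a := eulerPart 0
  set b := eulerPart 1
  set c := eulerPart 2
  refine ⟨a ^ 4 + (-8 : ℤ) * (b ^ 3 * c), (4 : ℤ) * (a ^ 3 * b) + (2 : ℤ) * (b ^ 2 * c ^ 2),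
    (2 : ℤ) * (a ^ 2 * b ^ 2) + (4 : ℤ) * (b * c ^ 3),
    (-8 : ℤ) * (a * b ^ 3) + c ^ 4, ?_, ?_, ?_, ?_, ?_, ?_⟩
  · exact ((ha.pow 4).congr (by norm_num)).add
      ((((hb.pow 3).mul hc).congr (by norm_num)).const_mul _)
  · exact ((((ha.pow 3).mul hb).congr (by norm_num)).const_mul _).add
      ((((hb.pow 2).mul (hc.pow 2)).congr (by norm_num)).const_mul _)
  · exact ((((ha.pow 2).mul (hb.pow 2)).congr (by norm_num)).const_mul _).add
      (((hb.mul (hc.pow 3)).congr (by norm_num)).const_mul _)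
  · exact (((ha.mul (hb.pow 3)).congr (by norm_num)).const_mul _).add
      ((hc.pow 4).congr (by norm_num))
  · push_cast
    grind
  · push_cast
    grind

lemma twentyFive_dvd_coeff_euler_pow_eight (g : ℤ⟦X⟧) (n : ℕ) (hn : n % 5 = 3) :
    25 ∣ coeff n (qFive g * pentagonalSeries ℤ ^ 8) := by
  obtain ⟨f₀, f₁, f₂, f₃, h₀, h₁, h₂, h₃, h, hE⟩ := euler_pow_four_dissection
  have hg := supportedMod_qFive g
  have hb := supportedMod_eulerPart 1 (by norm_num)
  set b := eulerPart 1
  have key : qFive g * pentagonalSeries ℤ ^ 8 = qFive g * f₀ ^ 2 + (2 : ℤ) * (qFive g * f₀ * f₁) +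
      (2 : ℤ) * (qFive g * f₀ * f₂) + qFive g * f₁ ^ 2 + qFive g * f₂ ^ 2 +
      (2 : ℤ) * (qFive g * f₁ * f₃) + (2 : ℤ) * (qFive g * f₂ * f₃) + qFive g * f₃ ^ 2 +
      (-10 : ℤ) * (qFive g * f₀ * b ^ 4) + (-10 : ℤ) * (qFive g * f₁ * b ^ 4) +
      (-10 : ℤ) * (qFive g * f₂ * b ^ 4) + (-10 : ℤ) * (qFive g * f₃ * b ^ 4) +
      (25 : ℤ) * (-5 * qFive g * b ^ 8) := by
    push_cast
    rw [show pentagonalSeries ℤ ^ 8 = (pentagonalSeries ℤ ^ 4) ^ 2 by ring, hE]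
    linear_combination 2 * qFive g * h
  have z1 := (hg.mul (h₀.pow 2)) n (by lia)
  have z2 := ((hg.mul h₀).mul h₁).const_mul 2 n (by lia)
  have z3 := ((hg.mul h₀).mul h₂).const_mul 2 n (by lia)
  have z4 := (hg.mul (h₁.pow 2)) n (by lia)
  have z5 := (hg.mul (h₂.pow 2)) n (by lia)
  have z6 := ((hg.mul h₁).mul h₃).const_mul 2 n (by lia)
  have z7 := ((hg.mul h₂).mul h₃).const_mul 2 n (by lia)
  have z8 := (hg.mul (h₃.pow 2)) n (by lia)
  have z9 := ((hg.mul h₀).mul (hb.pow 4)).const_mul (-10) n (by lia)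
  have z10 := ((hg.mul h₁).mul (hb.pow 4)).const_mul (-10) n (by lia)
  have z11 := ((hg.mul h₂).mul (hb.pow 4)).const_mul (-10) n (by lia)
  have z12 := ((hg.mul h₃).mul (hb.pow 4)).const_mul (-10) n (by lia)
  rw [key]
  simp only [map_add, z1, z2, z3, z4, z5, z6, z7, z8, z9, z10, z11, z12]
  simp only [zero_add]
  rw [← zsmul_eq_mul, map_zsmul]
  exact ⟨_, rfl⟩

lemma five_dvd_coeff_euler_pow_four (g : ℤ⟦X⟧) (n : ℕ) (hn : n % 5 = 4) :
    5 ∣ coeff n (qFive g * pentagonalSeries ℤ ^ 4) := by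
  obtain ⟨f₀, f₁, f₂, f₃, h₀, h₁, h₂, h₃, -, hE⟩ := euler_pow_four_dissection
  have hg := supportedMod_qFive g
  set b := eulerPart 1
  have key : qFive g * pentagonalSeries ℤ ^ 4 = qFive g * f₀ + qFive g * f₁ + qFive g * f₂ +
      qFive g * f₃ + (5 : ℤ) * (- qFive g * b ^ 4) := by
    push_cast
    rw [hE]
    ring
  rw [key]
  simp only [map_add, hg.mul h₀ n (by lia), hg.mul h₁ n (by lia), hg.mul h₂ n (by lia),
    hg.mul h₃ n (by lia), zero_add]
  rw [← zsmul_eq_mul, map_zsmul]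
  exact ⟨_, rfl⟩

lemma coeff_euler_cube (g : ℤ⟦X⟧) (n : ℕ) (hn : n % 5 = 3) :
    coeff n (qFive g * pentagonalSeries ℤ ^ 3) = -5 * coeff n (qFive g * eulerPart 1 ^ 3) := by
  obtain ⟨f₀, f₁, f₂, f₄, h₀, h₁, h₂, h₄, hE⟩ := euler_cube_dissection
  have hg := supportedMod_qFive g
  set b := eulerPart 1
  have key : qFive g * pentagonalSeries ℤ ^ 3 = qFive g * f₀ + qFive g * f₁ + qFive g * f₂ +
      qFive g * f₄ + (-5 : ℤ) * (qFive g * b ^ 3) := by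
    push_cast
    rw [hE]
    ring
  rw [key]
  simp only [map_add, hg.mul h₀ n (by lia), hg.mul h₁ n (by lia), hg.mul h₂ n (by lia),
    hg.mul h₄ n (by lia), zero_add]
  rw [← zsmul_eq_mul, map_zsmul, smul_eq_mul]

lemma dvd_of_forall_dvd_coeff {m : ℤ} {f : ℤ⟦X⟧} (h : ∀ n, m ∣ coeff n f) : (m : ℤ⟦X⟧) ∣ f := by
  choose g hg using h
  refine ⟨mk g, ?_⟩
  ext n
  rw [← zsmul_eq_mul, map_zsmul, coeff_mk, smul_eq_mul, hg]

lemma dvd_coeff_of_dvd {m : ℤ} {f : ℤ⟦X⟧} (h : (m : ℤ⟦X⟧) ∣ f) (n : ℕ) : m ∣ coeff n f := by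
  obtain ⟨g, rfl⟩ := h
  rw [← zsmul_eq_mul, map_zsmul]
  exact ⟨_, rfl⟩

lemma pow_five_sub_qFive (f : ℤ⟦X⟧) : ∃ g : ℤ⟦X⟧, f ^ 5 = qFive f + 5 * g := by
  have : ((5 : ℤ) : ℤ⟦X⟧) ∣ f ^ 5 - qFive f := by
    refine dvd_of_forall_dvd_coeff fun n => ?_
    rw [show (5 : ℤ) = ((5 : ℕ) : ℤ) by norm_num, ← ZMod.intCast_zmod_eq_zero_iff_dvd]
    have : Fact (Nat.Prime 5) := ⟨by norm_num⟩
    have h1 (g : (ZMod 5)⟦X⟧) : expand 5 (by norm_num) g = g ^ 5 := by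
      have h := MvPowerSeries.map_frobenius_expand (R := ZMod 5) (σ := Unit) 5 (by norm_num) (f := g)
      rw [ZMod.frobenius_zmod, MvPowerSeries.map_id] at h
      exact h
    have h2 : map (Int.castRingHom (ZMod 5)) (f ^ 5 - qFive f) = 0 := by
      rw [map_sub, map_pow, map_expand, sub_eq_zero, h1]
    have h3 := congrArg (coeff n) h2
    rw [coeff_map, map_zero] at h3
    exact h3
  obtain ⟨g, hg⟩ := this
  exact ⟨g, by push_cast at hg; linear_combination hg⟩

lemma twentyFive_dvd_coeff_sq {F : ℤ⟦X⟧}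
    (hF : F * pentagonalSeries ℤ = qFive (pentagonalSeries ℤ) ^ 5) (n : ℕ) :
    25 ∣ coeff (25 * n + 23) (F ^ 2) := by
  obtain ⟨Y, hY⟩ := pow_five_sub_qFive (pentagonalSeries ℤ)
  set E := pentagonalSeries ℤ with hE
  have hunit : IsUnit E := by
    rw [isUnit_iff_constantCoeff, ← coeff_zero_eq_constantCoeff_apply, hE,
      show 0 = pentagonal 0 by simp [pentagonal_def], coeff_pentagonalSeries_pentagonal]
    simp
  have h25 : ((25 : ℤ) : ℤ⟦X⟧) ∣ F ^ 2 -
      (4 * (qFive E ^ 8 * E ^ 8) - 3 * (qFive E ^ 9 * E ^ 3)) := by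
    refine (hunit.pow 2).dvd_mul_right.1 ?_
    refine ⟨- qFive E ^ 8 * Y * (qFive E + 4 * Y), ?_⟩
    push_cast
    linear_combination (F * E + qFive E ^ 5) * hF - qFive E ^ 8 * (4 * E ^ 5 + qFive E + 20 * Y) * hY
  have hc := dvd_coeff_of_dvd h25 (25 * n + 23)
  have h8 := twentyFive_dvd_coeff_euler_pow_eight (E ^ 8) (25 * n + 23) (by lia)
  have h3 := coeff_euler_cube (E ^ 9) (25 * n + 23) (by lia)
  have hb : qFive (E ^ 9) * eulerPart 1 ^ 3 = - (qFive (E ^ 9 * qFive E ^ 3) * X ^ 3) := by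
    rw [eulerPart_one, map_mul, map_pow (qFive) (qFive _)]
    ring
  rw [hb, map_neg, show 25 * n + 23 = 5 * (5 * n + 4) + 3 by ring, coeff_mul_X_pow,
    coeff_expand_mul] at h3
  have h4 := five_dvd_coeff_euler_pow_four (E ^ 4) (5 * n + 4) (by lia)
  have h5 : ((5 : ℤ) : ℤ⟦X⟧) ∣ E ^ 9 * qFive E ^ 3 - qFive (E ^ 4) * E ^ 4 := by
    refine ⟨Y * E ^ 4 * qFive E ^ 3, ?_⟩
    rw [map_pow]
    push_cast
    linear_combination (E ^ 4 * qFive E ^ 3) * hY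
  have h6 := dvd_coeff_of_dvd h5 (5 * n + 4)
  rw [map_sub] at h6
  have h7 := (dvd_sub_left h4).1 h6
  rw [map_pow] at h8 h3
  rw [show 5 * (5 * n + 4) + 3 = 25 * n + 23 by ring] at h3
  have e4 : coeff (25 * n + 23) (4 * (qFive E ^ 8 * E ^ 8)) =
      4 * coeff (25 * n + 23) (qFive E ^ 8 * E ^ 8) := by
    rw [show (4 : ℤ⟦X⟧) = ((4 : ℤ) : ℤ⟦X⟧) by norm_num, ← zsmul_eq_mul, map_zsmul, smul_eq_mul]
  have e3 : coeff (25 * n + 23) (3 * (qFive E ^ 9 * E ^ 3)) =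
      3 * coeff (25 * n + 23) (qFive E ^ 9 * E ^ 3) := by
    rw [show (3 : ℤ⟦X⟧) = ((3 : ℤ) : ℤ⟦X⟧) by norm_num, ← zsmul_eq_mul, map_zsmul, smul_eq_mul]
  rw [map_sub, map_sub, e4, e3, h3] at hc
  obtain ⟨u, hu⟩ := h7
  obtain ⟨v, hv⟩ := h8
  obtain ⟨w, hw⟩ := hc
  exact ⟨w + 4 * v - 3 * u, by linear_combination hw + 4 * hv - 15 * hu⟩

/-- The finite product `(q; q)_r`. -/
noncomputable def qPochhammer (r : ℕ) : ℤ⟦X⟧ := ∏ m ∈ range r, (1 - X ^ (m + 1))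

lemma constantCoeff_qPochhammer (r : ℕ) : constantCoeff (qPochhammer r) = 1 := by
  simp [qPochhammer, map_prod]

lemma isUnit_qPochhammer (r : ℕ) : IsUnit (qPochhammer r) := by
  rw [isUnit_iff_constantCoeff, constantCoeff_qPochhammer]
  exact isUnit_one

lemma X_pow_dvd_prod_sub_qPochhammer (r : ℕ) (s : Finset ℕ) (hs : range r ⊆ s) :
    (X : ℤ⟦X⟧) ^ (r + 1) ∣ ∏ m ∈ s, (1 - X ^ (m + 1)) - qPochhammer r := by
  rw [← prod_sdiff hs, qPochhammer, ← sub_one_mul]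
  refine Dvd.dvd.mul_right ?_ _
  refine Finset.prod_induction _ (fun f : ℤ⟦X⟧ => X ^ (r + 1) ∣ f - 1) ?_ (by simp) ?_
  · intro f g hf hg
    rw [show f * g - 1 = (f - 1) * g + (g - 1) by ring]
    exact dvd_add (hf.mul_right _) hg
  · intro m hm
    have hm' : r ≤ m := by simpa using (mem_sdiff.1 hm).2
    rw [sub_sub_cancel_left, dvd_neg]
    exact pow_dvd_pow _ (by lia)

lemma X_pow_dvd_pentagonalSeries_sub (r : ℕ) :
    (X : ℤ⟦X⟧) ^ (r + 1) ∣ pentagonalSeries ℤ - qPochhammer r := by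
  rw [X_pow_dvd_iff]
  intro n hn
  obtain ⟨s, hs⟩ := Filter.eventually_atTop.1 (coeff_prod_one_sub_X_pow_eventually_eq ℤ n)
  rw [map_sub, ← hs (s ∪ range r) subset_union_left, ← map_sub]
  exact X_pow_dvd_iff.1 (X_pow_dvd_prod_sub_qPochhammer r _ subset_union_right) n hn

lemma exists_euler_tail (r : ℕ) : ∃ U : ℤ⟦X⟧, pentagonalSeries ℤ = qPochhammer r * U ∧
    X ^ (r + 1) ∣ U - 1 := by
  obtain ⟨U, hU⟩ := (isUnit_qPochhammer r).dvd (a := pentagonalSeries ℤ)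
  refine ⟨U, hU, (isUnit_qPochhammer r).dvd_mul_left.1 ?_⟩
  have := X_pow_dvd_pentagonalSeries_sub r
  rwa [hU, ← mul_sub_one] at this

/-- Euler's recurrence determines `q^(r choose 2) / (q; q)_r`. -/
lemma mul_prod_eq_of_recurrence {h : ℕ → ℤ⟦X⟧} {q : ℤ⟦X⟧} (h0 : h 0 = 1)
    (hs : ∀ r, h (r + 1) * (1 - q ^ (r + 1)) = q ^ r * h r) (r : ℕ) :
    h r * ∏ m ∈ range r, (1 - q ^ (m + 1)) = q ^ r.choose 2 := by
  induction r with
  | zero => simp [h0]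
  | succ r ih =>
    rw [prod_range_succ, Nat.choose_succ_succ' r 1, Nat.choose_one_right,
      pow_add q r (r.choose (1 + 1)), ← ih]
    linear_combination (∏ m ∈ range r, (1 - q ^ (m + 1))) * hs r

lemma exists_euler_recurrence : ∃ w : ℕ → ℤ⟦X⟧, w 0 = 1 ∧
    ∀ r, w (r + 1) * (1 - (X ^ 5) ^ (r + 1)) = (X ^ 5) ^ r * w r := by
  have hu (r : ℕ) : IsUnit (1 - (X ^ 5) ^ (r + 1) : ℤ⟦X⟧) := by
    rw [isUnit_iff_constantCoeff]
    simp
  choose v hv using fun r => (hu r).exists_left_inv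
  refine ⟨fun r => Nat.rec 1 (fun s x => (X ^ 5) ^ s * x * v s) r, rfl, fun r => ?_⟩
  simp only
  rw [mul_assoc, hv, mul_one]

/-- The exponent attached to the numbers of beads on the five runners of an abacus. -/
def runnerWeight (v : Fin 5 →₀ ℕ) : ℕ := ∑ i : Fin 5, ((i : ℕ) * v i + 5 * (v i).choose 2)

lemma sum_runners_mul_qPochhammer {w : ℕ → ℤ⟦X⟧} (hw0 : w 0 = 1)
    (hw : ∀ r, w (r + 1) * (1 - (X ^ 5) ^ (r + 1)) = (X ^ 5) ^ r * w r) (r : ℕ) :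
    (∑ v ∈ finsuppAntidiag (univ : Finset (Fin 5)) r, ∏ i : Fin 5, ((X ^ (i : ℕ)) ^ v i * w (v i))) *
      qPochhammer r = X ^ r.choose 2 := by
  set T : ℤ⟦X⟧⟦X⟧ := mk w with hT
  set H : ℤ⟦X⟧⟦X⟧ := ∏ i : Fin 5, rescale (X ^ (i : ℕ)) T with hH
  have hTf : T = (1 + X) * rescale (X ^ 5) T := by
    ext1 n
    rcases n with _ | n
    · rw [add_mul, one_mul, map_add, coeff_zero_X_mul, coeff_rescale, pow_zero, one_mul, add_zero]
    · rw [add_mul, one_mul, map_add, coeff_succ_X_mul, coeff_rescale, coeff_rescale, hT, coeff_mk,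
        coeff_mk]
      linear_combination hw n
  have hHf : H = (1 + X) * rescale X H := by
    have e : H = T * rescale X T * rescale (X ^ 2) T * rescale (X ^ 3) T * rescale (X ^ 4) T := by
      simp [hH, Fin.prod_univ_five]
    have e' : rescale X H = rescale X T * rescale (X ^ 2) T * rescale (X ^ 3) T *
        rescale (X ^ 4) T * rescale (X ^ 5) T := by
      simp only [e, map_mul, rescale_rescale, ← pow_succ, ← pow_two]
    rw [e', e]
    linear_combination (rescale X T * rescale (X ^ 2) T * rescale (X ^ 3) T *
      rescale (X ^ 4) T) * hTf
  have hcoeff (r : ℕ) : coeff r H =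
      ∑ v ∈ finsuppAntidiag (univ : Finset (Fin 5)) r,
        ∏ i : Fin 5, ((X ^ (i : ℕ)) ^ v i * w (v i)) := by
    rw [hH, coeff_prod]
    simp only [coeff_rescale, hT, coeff_mk]
  rw [← hcoeff]
  refine mul_prod_eq_of_recurrence (h := fun r => coeff r H) (q := X) ?_ ?_ r
  · simp [hH, hT, hw0, coeff_prod]
  · intro r
    have := congrArg (coeff (r + 1)) hHf
    rw [add_mul, one_mul, map_add, coeff_succ_X_mul, coeff_rescale, coeff_rescale] at this
    linear_combination this

lemma runnerWeight_bounds {v : Fin 5 →₀ ℕ} {R : ℕ} (hv : ∑ i, v i = 5 * R) (i : Fin 5) :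
    2 * (5 * R).choose 2 + (R - v i) ≤ 2 * runnerWeight v := by
  have hc (m : ℕ) : 2 * ((m.choose 2 : ℕ) : ℤ) = (m : ℤ) * (m - 1) := by
    rcases m with _ | m
    · simp
    · have h := Nat.choose_two_right (m + 1)
      have h2 : 2 * (m + 1).choose 2 = (m + 1) * m := by
        rw [h]
        exact Nat.mul_div_cancel'
          (by simpa using (Nat.even_mul_succ_self m).two_dvd.trans (by rw [mul_comm]))
      zify at h2
      push_cast
      linarith
  have hd (d c : ℤ) (h1 : -2 ≤ c) (h2 : c ≤ 2) : 0 ≤ d * (5 * d + 2 * c) ∧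
      -d ≤ d * (5 * d + 2 * c) := by
    rcases lt_trichotomy d 0 with h | h | h
    · constructor <;> nlinarith
    · simp [h]
    · constructor <;> nlinarith
  simp only [runnerWeight, Fin.sum_univ_five] at hv ⊢
  have c0 := hc (v 0)
  have c1 := hc (v 1)
  have c2 := hc (v 2)
  have c3 := hc (v 3)
  have c4 := hc (v 4)
  have cR := hc (5 * R)
  have d0 := hd (v 0 - R) (-2) (by norm_num) (by norm_num)
  have d1 := hd (v 1 - R) (-1) (by norm_num) (by norm_num)
  have d2 := hd (v 2 - R) 0 (by norm_num) (by norm_num)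
  have d3 := hd (v 3 - R) 1 (by norm_num) (by norm_num)
  have d4 := hd (v 4 - R) 2 (by norm_num) (by norm_num)
  rw [show ((3 : Fin 5) : ℕ) = 3 from rfl, show ((4 : Fin 5) : ℕ) = 4 from rfl]
  simp only [Fin.val_zero, Fin.val_one, Fin.val_two]
  zify at hv
  push_cast at cR
  have key : 2 * ((0 * v 0 + 5 * (v 0).choose 2 + (1 * v 1 + 5 * (v 1).choose 2) +
      (2 * v 2 + 5 * (v 2).choose 2) + (3 * v 3 + 5 * (v 3).choose 2) +
      (4 * v 4 + 5 * (v 4).choose 2) : ℕ) : ℤ) - 2 * ((5 * R).choose 2 : ℕ) =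
      (v 0 - R : ℤ) * (5 * (v 0 - R) + 2 * (-2)) + (v 1 - R : ℤ) * (5 * (v 1 - R) + 2 * (-1)) +
      (v 2 - R : ℤ) * (5 * (v 2 - R) + 2 * 0) + (v 3 - R : ℤ) * (5 * (v 3 - R) + 2 * 1) +
      (v 4 - R : ℤ) * (5 * (v 4 - R) + 2 * 2) := by
    push_cast
    linear_combination 5 * c0 + 5 * c1 + 5 * c2 + 5 * c3 + 5 * c4 - cR + (10 * R - 1) * hv
  generalize (5 * R).choose 2 = z at *
  generalize (v 0 - R : ℤ) * (5 * (v 0 - R) + 2 * (-2)) = y0 at *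
  generalize (v 1 - R : ℤ) * (5 * (v 1 - R) + 2 * (-1)) = y1 at *
  generalize (v 2 - R : ℤ) * (5 * (v 2 - R) + 2 * 0) = y2 at *
  generalize (v 3 - R : ℤ) * (5 * (v 3 - R) + 2 * 1) = y3 at *
  generalize (v 4 - R : ℤ) * (5 * (v 4 - R) + 2 * 2) = y4 at *
  clear c0 c1 c2 c3 c4 cR hc hd
  fin_cases i <;> simp only [Fin.zero_eta, Fin.mk_one, Fin.reduceFinMk] <;> omega

lemma euler_mul_sum_runnerWeight {N R : ℕ} (hR : 3 * N + 2 ≤ R) :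
    (X : ℤ⟦X⟧) ^ ((5 * R).choose 2 + (N + 1)) ∣
      pentagonalSeries ℤ *
        ∑ v ∈ finsuppAntidiag (univ : Finset (Fin 5)) (5 * R), X ^ runnerWeight v -
      qFive (pentagonalSeries ℤ) ^ 5 * X ^ (5 * R).choose 2 := by
  obtain ⟨w, hw0, hw⟩ := exists_euler_recurrence
  choose U hU hU1 using exists_euler_tail
  set E := pentagonalSeries ℤ with hE
  have hwE (s : ℕ) : w s * qFive E = X ^ (5 * s.choose 2) * qFive (U s) := by
    have h := mul_prod_eq_of_recurrence hw0 hw s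
    have h' : qFive (qPochhammer s) = ∏ m ∈ range s, (1 - (X ^ 5) ^ (m + 1)) := by
      simp [qPochhammer, map_prod]
    rw [hU s, map_mul, h', ← mul_assoc, h, ← pow_mul]
  have hsum := sum_runners_mul_qPochhammer hw0 hw (5 * R)
  have hprod : E * ∑ v ∈ finsuppAntidiag (univ : Finset (Fin 5)) (5 * R),
      X ^ runnerWeight v * ∏ i, qFive (U (v i)) =
      qFive E ^ 5 * X ^ (5 * R).choose 2 * U (5 * R) := by
    rw [← hsum]
    conv_rhs => rw [mul_assoc, mul_assoc, ← hU (5 * R)]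
    rw [mul_comm E, ← mul_assoc, mul_sum]
    congr 1
    refine sum_congr rfl fun v _ => ?_
    rw [show qFive E ^ 5 = ∏ _i : Fin 5, qFive E by simp, ← prod_mul_distrib, runnerWeight,
      ← prod_pow_eq_pow_sum, ← prod_mul_distrib]
    refine prod_congr rfl fun i _ => ?_
    rw [mul_comm (qFive E), mul_assoc, hwE, ← mul_assoc, ← pow_mul, pow_add]
  have hterm : ∀ v ∈ finsuppAntidiag (univ : Finset (Fin 5)) (5 * R),
      (X : ℤ⟦X⟧) ^ ((5 * R).choose 2 + (N + 1)) ∣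
        X ^ runnerWeight v * ∏ i, qFive (U (v i)) - X ^ runnerWeight v := by
    intro v hv
    have hv' : ∑ i, v i = 5 * R := (mem_finsuppAntidiag.1 hv).1
    rw [← mul_sub_one]
    by_cases hlarge : (5 * R).choose 2 + (N + 1) ≤ runnerWeight v
    · exact (pow_dvd_pow _ hlarge).mul_right _
    · rw [pow_add]
      refine mul_dvd_mul (pow_dvd_pow _ (by have := runnerWeight_bounds hv' 0; lia)) ?_
      refine Finset.prod_induction _ (fun f : ℤ⟦X⟧ => X ^ (N + 1) ∣ f - 1) ?_ (by simp) ?_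
      · intro f g hf hg
        rw [show f * g - 1 = (f - 1) * g + (g - 1) by ring]
        exact dvd_add (hf.mul_right _) hg
      · intro i _
        have hi := runnerWeight_bounds hv' i
        have h := map_dvd qFive (hU1 (v i))
        rw [map_pow, expand_X, map_sub, map_one, ← pow_mul] at h
        exact (pow_dvd_pow _ (by lia)).trans h
  have h1 := dvd_sum hterm
  rw [sum_sub_distrib] at h1
  have h2 : (X : ℤ⟦X⟧) ^ ((5 * R).choose 2 + (N + 1)) ∣
      qFive E ^ 5 * X ^ (5 * R).choose 2 * U (5 * R) - qFive E ^ 5 * X ^ (5 * R).choose 2 := by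
    rw [← mul_sub_one, pow_add]
    exact mul_dvd_mul (Dvd.intro_left _ rfl) ((pow_dvd_pow _ (by lia)).trans (hU1 (5 * R)))
  have h3 := dvd_sub h2 (h1.mul_left E)
  rw [mul_sub, hprod] at h3
  convert h3 using 1
  ring

/-- The `i`-th largest part of a partition, zero when there is none. -/
def partRow {n : ℕ} (p : n.Partition) (i : ℕ) : ℕ := (p.parts.sort (· ≤ ·)).reverse.getD i 0

/-- The number of parts exceeding `j`, that is, the length of column `j`. -/
def partCol {n : ℕ} (p : n.Partition) (j : ℕ) : ℕ := (p.parts.filter (fun x => j < x)).card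

lemma lt_getD_iff_lt_countP {l : List ℕ} (hl : l.Pairwise (· ≥ ·)) (i j : ℕ) :
    j < l.getD i 0 ↔ i < l.countP (fun x => decide (j < x)) := by
  induction l generalizing i with
  | nil => simp
  | cons a t ih =>
    rw [List.pairwise_cons] at hl
    by_cases ha : j < a
    · rcases i with _ | i
      · simp [ha]
      · simpa [ha] using ih hl.2 i
    · have h0 : t.countP (fun x => decide (j < x)) = 0 := by
        rw [List.countP_eq_zero]
        intro x hx
        have := hl.1 x hx
        simpa using this.trans (not_lt.1 ha)
      rcases i with _ | i
      · simp [ha, h0]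
      · simpa [ha, h0] using (ih hl.2 i).not

lemma sum_range_getD (l : List ℕ) {r : ℕ} (hr : l.length ≤ r) :
    ∑ i ∈ range r, l.getD i 0 = l.sum := by
  induction l generalizing r with
  | nil => simp
  | cons a t ih =>
    obtain ⟨r, rfl⟩ : ∃ s, r = s + 1 := ⟨r - 1, by simp at hr; lia⟩
    rw [sum_range_succ', List.sum_cons, ← ih (r := r) (by simpa using hr)]
    simp [add_comm]

section Partition

variable {n : ℕ} (p : n.Partition)

lemma lt_partRow_iff (i j : ℕ) : j < partRow p i ↔ i < partCol p j := by
  rw [partRow, lt_getD_iff_lt_countP, List.countP_reverse, partCol]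
  · rw [← Multiset.coe_countP, Multiset.sort_eq, Multiset.countP_eq_card_filter]
  · rw [List.pairwise_reverse]
    exact Multiset.pairwise_sort _ _

lemma partRow_anti {i i' : ℕ} (h : i ≤ i') : partRow p i' ≤ partRow p i := by
  by_contra! hlt
  exact absurd ((lt_partRow_iff p _ _).2 (h.trans_lt ((lt_partRow_iff p _ _).1 hlt))) (lt_irrefl _)

lemma card_parts_le : p.parts.card ≤ n := by
  have h := Multiset.card_nsmul_le_sum (s := p.parts) (a := 1) fun x hx => p.parts_pos hx
  simpa [p.parts_sum] using h

lemma partCol_le (j : ℕ) : partCol p j ≤ n :=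
  (Multiset.card_le_card (Multiset.filter_le _ _)).trans (card_parts_le p)

lemma sum_partRow {r : ℕ} (hr : n ≤ r) : ∑ i ∈ range r, partRow p i = n := by
  unfold partRow
  rw [sum_range_getD _ (by simpa using (card_parts_le p).trans hr), List.sum_reverse,
    ← Multiset.sum_coe, Multiset.sort_eq, p.parts_sum]

variable {p} in
lemma partition_eq_of_partRow_eq {p' : n.Partition} (h : ∀ i < n, partRow p i = partRow p' i) :
    p = p' := by
  have hcol (j : ℕ) : partCol p j = partCol p' j := by
    refine eq_of_forall_lt_iff fun i => ?_
    by_cases hi : i < n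
    · rw [← lt_partRow_iff, ← lt_partRow_iff, h i hi]
    · have := partCol_le p j
      have := partCol_le p' j
      lia
  have hcount (q : n.Partition) (x : ℕ) : q.parts.count (x + 1) + partCol q (x + 1) =
      partCol q x := by
    rw [partCol, partCol, ← Multiset.countP_eq_card_filter, ← Multiset.countP_eq_card_filter,
      Multiset.count]
    induction q.parts using Multiset.induction with
    | empty => simp
    | cons a s ih =>
      simp only [Multiset.countP_cons]
      split_ifs <;> lia
  ext x
  rcases x with _ | x
  · rw [Multiset.count_eq_zero_of_notMem, Multiset.count_eq_zero_of_notMem] <;>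
      exact fun h0 => (Nat.Partition.parts_pos _ h0).ne' rfl
  · have h1 := hcount p x
    have h2 := hcount p' x
    rw [hcol, hcol] at h1
    lia

/-- The bead positions of a partition on an abacus with `r` beads. -/
def beads (r : ℕ) : Finset ℕ := (range r).image fun x => partRow p (r - 1 - x) + x

lemma bead_strictMono (r : ℕ) : StrictMono fun x => partRow p (r - 1 - x) + x := fun x y h => by
  have := partRow_anti p (show r - 1 - y ≤ r - 1 - x by lia)
  simp only
  lia

lemma card_beads (r : ℕ) : (beads p r).card = r := by
  rw [beads, card_image_of_injective _ (bead_strictMono p r).injective, card_range]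

lemma sum_beads {r : ℕ} (hr : n ≤ r) : ∑ b ∈ beads p r, b = n + r.choose 2 := by
  rw [beads, sum_image (bead_strictMono p r).injective.injOn, sum_add_distrib,
    sum_range_reflect (partRow p) r, sum_partRow p hr, sum_range_id, Nat.choose_two_right]

lemma mem_beads_iff {r b : ℕ} : b ∈ beads p r ↔ ∃ x < r, partRow p (r - 1 - x) + x = b := by
  simp [beads]

lemma gap_notMem_beads {r : ℕ} (hr : n ≤ r) (j : ℕ) : j + (r - partCol p j) ∉ beads p r := by
  rw [mem_beads_iff]
  rintro ⟨x, hx, h⟩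
  have hc := partCol_le p j
  have h1 := lt_partRow_iff p (r - 1 - x) j
  by_cases h2 : j < partRow p (r - 1 - x)
  · have := h1.1 h2
    lia
  · have := h1.not.1 h2
    lia

variable {p} in
lemma beads_injective {r : ℕ} (hr : n ≤ r) {p' : n.Partition} (h : beads p r = beads p' r) :
    p = p' := by
  have key (q : n.Partition) (hq : beads q r = beads p r) :
      (fun x : Fin r => partRow q (r - 1 - x) + x) = (beads p r).orderEmbOfFin (card_beads p r) :=
    orderEmbOfFin_unique _ (fun x => by rw [← hq, mem_beads_iff]; exact ⟨x, x.2, rfl⟩)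
      fun x y hxy => bead_strictMono q r hxy
  refine partition_eq_of_partRow_eq fun i hi => ?_
  have h1 := congrFun ((key p rfl).trans (key p' h.symm).symm) ⟨r - 1 - i, by lia⟩
  simp only [show r - 1 - (r - 1 - i) = i by lia] at h1
  lia

lemma isTCore_iff_beads {t r : ℕ} (hr : n ≤ r) (ht : 0 < t) :
    IsTCore t p ↔ ∀ c, c + t ∈ beads p r → c ∈ beads p r := by
  have hhook (i j : ℕ) : hookLength p i j = (partRow p i - j) + (partCol p j - i) - 1 := rfl
  constructor
  · intro hp c hb
    by_contra hc
    obtain ⟨x, hx, hxb⟩ := (mem_beads_iff p).1 hb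
    have hex : ∃ m, c < partRow p (r - 1 - m) + m := ⟨x, by lia⟩
    classical
    obtain ⟨m, hm, hmin⟩ : ∃ m, c < partRow p (r - 1 - m) + m ∧
        ∀ y < m, ¬ c < partRow p (r - 1 - y) + y :=
      ⟨Nat.find hex, Nat.find_spec hex, fun y hy => Nat.find_min hex hy⟩
    have hmx : m ≤ x := by
      by_contra! h
      exact hmin x h (by lia)
    have hpred : m = 0 ∨ (m ≤ c ∧ partRow p (r - m) ≤ c - m) := by
      rcases m with _ | m
      · exact .inl rfl
      · have h1 := hmin m (by lia)
        have h2 : partRow p (r - 1 - m) + m ≠ c := fun h =>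
          hc ((mem_beads_iff p).2 ⟨m, by lia, h⟩)
        rw [show r - (m + 1) = r - 1 - m by lia]
        right
        lia
    have hcol : partCol p (c - m) = r - m := by
      have h1 := (lt_partRow_iff p (r - 1 - m) (c - m)).1 (by lia)
      have h2 := (lt_partRow_iff p (r - m) (c - m)).not
      have h3 := partCol_le p (c - m)
      lia
    have hlt : c - m < partRow p (r - 1 - x) := (lt_partRow_iff p _ _).2 (by lia)
    refine hp (r - 1 - x) (c - m) hlt ?_
    rw [hhook, hcol]
    exact dvd_of_eq (by lia)
  · rintro hcl i j hij ⟨k, hk⟩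
    have hij' : i < partCol p j := (lt_partRow_iff p i j).1 hij
    change j < partRow p i at hij
    have hc := partCol_le p j
    have hiter (k c : ℕ) (h : c + t * k ∈ beads p r) : c ∈ beads p r := by
      induction k with
      | zero => simpa using h
      | succ k ih => exact ih (hcl _ (by rwa [mul_add_one, ← add_assoc] at h))
    refine gap_notMem_beads p hr j (hiter k _ ?_)
    rw [← hk, hhook, mem_beads_iff]
    refine ⟨r - 1 - i, by lia, ?_⟩
    rw [show r - 1 - (r - 1 - i) = i by lia]
    lia

end Partition

lemma exists_beads_eq {n r : ℕ} {S : Finset ℕ} (hS : S.card = r)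
    (hsum : ∑ b ∈ S, b = n + r.choose 2) : ∃ p : n.Partition, beads p r = S := by
  set e := S.orderEmbOfFin hS with he
  have hmono (x y : ℕ) (hy : y < r) (h : x ≤ y) :
      e ⟨x, by lia⟩ + (y - x) ≤ e ⟨y, hy⟩ := by
    induction y, h using Nat.le_induction with
    | base => simp
    | succ y h ih =>
      have h1 := ih (by lia)
      have h2 : e ⟨y, by lia⟩ < e ⟨y + 1, hy⟩ := e.strictMono (by simp)
      lia
  have hle (x : ℕ) (hx : x < r) : x ≤ e ⟨x, hx⟩ := by
    have := hmono 0 x hx (by lia)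
    lia
  let g : ℕ → ℕ := fun i => if h : i < r then e ⟨r - 1 - i, by lia⟩ - (r - 1 - i) else 0
  have hg (i : ℕ) (h : i < r) : g i + (r - 1 - i) = e ⟨r - 1 - i, by lia⟩ := by
    have := hle (r - 1 - i) (by lia)
    simp only [g, dif_pos h]
    lia
  have hganti (i i' : ℕ) (h : i ≤ i') (hi : i' < r) : g i' ≤ g i := by
    have h1 := hg i (by lia)
    have h2 := hg i' hi
    have h3 := hmono (r - 1 - i') (r - 1 - i) (by lia) (by lia)
    lia
  have hgsum : ∑ i ∈ range r, g i = n := by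
    have h1 : ∑ x ∈ range r, (g (r - 1 - x) + x) = n + r.choose 2 := by
      rw [← hsum, ← S.image_orderEmbOfFin_univ hS, sum_image e.injective.injOn,
        ← Fin.sum_univ_eq_sum_range fun x => g (r - 1 - x) + x]
      refine sum_congr rfl fun x _ => ?_
      have := hg (r - 1 - x) (by lia)
      simpa only [show r - 1 - (r - 1 - (x : ℕ)) = x by lia] using this
    rw [sum_add_distrib, sum_range_reflect g, sum_range_id, ← Nat.choose_two_right] at h1
    lia
  let p : n.Partition := Nat.Partition.ofSums n ((Multiset.range r).map g) hgsum
  have hcol (j : ℕ) : partCol p j = ((range r).filter fun i => j < g i).card := by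
    have hp : p.parts = ((Multiset.range r).map g).filter (· ≠ 0) := rfl
    rw [partCol, hp, Multiset.filter_filter, Multiset.filter_map, Multiset.card_map]
    refine congrArg Multiset.card (Multiset.filter_congr fun x _ => ?_)
    simp only [Function.comp_apply]
    lia
  have hrow (i : ℕ) (hi : i < r) : partRow p i = g i := by
    refine eq_of_forall_lt_iff fun j => ?_
    rw [lt_partRow_iff, hcol]
    constructor
    · intro h
      by_contra! hj
      refine absurd (card_le_card (t := range i) fun x hx => ?_) (by simpa using h)
      rw [mem_filter, mem_range] at hx
      rw [mem_range]
      by_contra! hx'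
      have := hganti i x hx' hx.1
      lia
    · intro h
      have := card_le_card (s := range (i + 1)) (t := (range r).filter fun i => j < g i)
        fun x hx => by
          rw [mem_range] at hx
          rw [mem_filter, mem_range]
          exact ⟨by lia, h.trans_le (hganti x i (by lia) hi)⟩
      rw [card_range] at this
      lia
  refine ⟨p, eq_of_subset_of_card_le (fun b hb => ?_) (by rw [card_beads, hS])⟩
  obtain ⟨x, hx, rfl⟩ := (mem_beads_iff p).1 hb
  have := hg (r - 1 - x) (by lia)
  rw [hrow _ (by lia)]
  simp only [show r - 1 - (r - 1 - x) = x by lia] at this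
  rw [this]
  exact orderEmbOfFin_mem _ _ _

/-- The bead positions on a five-runner abacus with `v i` consecutive beads on runner `i`. -/
def runnerBeads (v : Fin 5 →₀ ℕ) : Finset ℕ :=
  univ.biUnion fun i : Fin 5 => (range (v i)).image fun m => 5 * m + i

lemma mem_runnerBeads_iff {v : Fin 5 →₀ ℕ} {i : Fin 5} {m : ℕ} :
    5 * m + i ∈ runnerBeads v ↔ m < v i := by
  simp only [runnerBeads, mem_biUnion, mem_univ, true_and, mem_image, mem_range]
  constructor
  · rintro ⟨i', m', h, h'⟩
    obtain rfl : i' = i := by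
      ext
      lia
    lia
  · exact fun h => ⟨i, m, h, rfl⟩

lemma sum_runnerBeads (v : Fin 5 →₀ ℕ) (f : ℕ → ℕ) :
    ∑ b ∈ runnerBeads v, f b = ∑ i : Fin 5, ∑ m ∈ range (v i), f (5 * m + i) := by
  rw [runnerBeads, sum_biUnion]
  · refine sum_congr rfl fun i _ => sum_image fun m _ m' _ h => ?_
    lia
  · intro i _ i' _ h
    rw [Function.onFun, disjoint_left]
    intro b hb hb'
    obtain ⟨m, -, hm⟩ := mem_image.1 hb
    obtain ⟨m', -, hm'⟩ := mem_image.1 hb'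
    exact h (by ext; lia)

lemma card_runnerBeads (v : Fin 5 →₀ ℕ) : (runnerBeads v).card = ∑ i, v i := by
  rw [card_eq_sum_ones, sum_runnerBeads]
  simp

lemma sum_id_runnerBeads (v : Fin 5 →₀ ℕ) : ∑ b ∈ runnerBeads v, b = runnerWeight v := by
  rw [sum_runnerBeads v fun b => b, runnerWeight]
  refine sum_congr rfl fun i _ => ?_
  rw [sum_add_distrib, ← mul_sum, sum_range_id, Nat.choose_two_right]
  simp
  ring

lemma runnerBeads_injective : Function.Injective runnerBeads := fun v v' h => by
  ext i
  refine eq_of_forall_lt_iff fun m => ?_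
  rw [← mem_runnerBeads_iff, h, mem_runnerBeads_iff]

lemma eq_range_card {s : Finset ℕ} (hs : ∀ m, m + 1 ∈ s → m ∈ s) : s = range s.card := by
  refine eq_of_subset_of_card_le (fun m hm => ?_) (by simp)
  have hsub : range (m + 1) ⊆ s := by
    intro k hk
    rw [mem_range] at hk
    exact Nat.decreasingInduction (motive := fun k _ => k ∈ s) (fun k _ h => hs k h) hm
      (Nat.le_of_lt_succ hk)
  simpa using card_le_card hsub

lemma exists_runnerBeads_eq_iff {s : Finset ℕ} :
    (∃ v, runnerBeads v = s) ↔ ∀ c, c + 5 ∈ s → c ∈ s := by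
  constructor
  · rintro ⟨v, rfl⟩ c hc
    obtain ⟨m, i, rfl⟩ : ∃ (m : ℕ) (i : Fin 5), c = 5 * m + i :=
      ⟨c / 5, ⟨c % 5, by lia⟩, by simp only; lia⟩
    rw [show 5 * m + (i : ℕ) + 5 = 5 * (m + 1) + i by ring, mem_runnerBeads_iff] at hc
    exact mem_runnerBeads_iff.2 (by lia)
  · intro h
    let runner (i : Fin 5) : Finset ℕ := (range (s.sup id + 1)).filter fun m => 5 * m + i ∈ s
    have hmem (i : Fin 5) (m : ℕ) : m ∈ runner i ↔ 5 * m + i ∈ s := by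
      simp only [runner, mem_filter, mem_range, and_iff_right_iff_imp]
      intro hm
      have : 5 * m + i ≤ s.sup id := le_sup (f := id) hm
      lia
    have hrange (i : Fin 5) : runner i = range (runner i).card := eq_range_card fun m hm => by
      rw [hmem] at hm ⊢
      exact h _ (by rwa [mul_add_one, add_right_comm] at hm)
    refine ⟨Finsupp.equivFunOnFinite.symm fun i => (runner i).card, ?_⟩
    ext b
    obtain ⟨m, i, rfl⟩ : ∃ (m : ℕ) (i : Fin 5), b = 5 * m + i :=
      ⟨b / 5, ⟨b % 5, by lia⟩, by simp only; lia⟩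
    rw [mem_runnerBeads_iff, ← hmem, hrange]
    simp

/-- The number of `t`-core partitions of `n`. -/
noncomputable def numCores (t n : ℕ) : ℕ := Nat.card { p : n.Partition // IsTCore t p }

lemma numCores_five_eq {n r : ℕ} (hr : n ≤ r) :
    numCores 5 n = ((finsuppAntidiag (univ : Finset (Fin 5)) r).filter
      fun v => runnerWeight v = n + r.choose 2).card := by
  classical
  rw [numCores, Nat.card_eq_fintype_card, Fintype.card_subtype,
    ← card_image_of_injective _ runnerBeads_injective,
    ← card_image_of_injOn (f := fun p => beads p r) fun p _ p' _ h => beads_injective hr h]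
  congr 1
  ext s
  simp only [mem_image, mem_filter, mem_univ, true_and, mem_finsuppAntidiag, subset_univ, and_true]
  constructor
  · rintro ⟨p, hp, rfl⟩
    obtain ⟨v, hv⟩ := exists_runnerBeads_eq_iff.2 ((isTCore_iff_beads p hr (by norm_num)).1 hp)
    refine ⟨v, ⟨?_, ?_⟩, hv⟩
    · rw [← card_runnerBeads, hv, card_beads]
    · rw [← sum_id_runnerBeads, hv, sum_beads p hr]
  · rintro ⟨v, ⟨hv, hw⟩, rfl⟩
    obtain ⟨p, hp⟩ := exists_beads_eq (S := runnerBeads v) (by rw [card_runnerBeads, hv])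
      (by rw [sum_id_runnerBeads, hw])
    refine ⟨p, (isTCore_iff_beads p hr (by norm_num)).2 ?_, hp⟩
    rw [hp]
    exact exists_runnerBeads_eq_iff.1 ⟨v, rfl⟩

lemma numA_two (t n : ℕ) :
    numA t 2 n = ∑ x ∈ antidiagonal n, numCores t x.1 * numCores t x.2 := by
  classical
  let e : { f : Fin 2 → Σ m : Fin (n + 1), Nat.Partition (m : ℕ) //
      (∑ i, ((f i).1 : ℕ)) = n ∧ ∀ i, IsTCore t (f i).2 } ≃
      Σ x : antidiagonal n, { p : Nat.Partition x.1.1 // IsTCore t p } ×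
        { p : Nat.Partition x.1.2 // IsTCore t p } :=
    { toFun f := ⟨⟨((f.1 0).1, (f.1 1).1), by simpa [Fin.sum_univ_two] using f.2.1⟩,
        ⟨(f.1 0).2, f.2.2 0⟩, ⟨(f.1 1).2, f.2.2 1⟩⟩
      invFun y := ⟨![⟨⟨y.1.1.1, by have := mem_antidiagonal.1 y.1.2; lia⟩, y.2.1.1⟩,
          ⟨⟨y.1.1.2, by have := mem_antidiagonal.1 y.1.2; lia⟩, y.2.2.1⟩],
        by
          rw [Fin.sum_univ_two]
          exact mem_antidiagonal.1 y.1.2, by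
          rw [Fin.forall_fin_two]
          exact ⟨y.2.1.2, y.2.2.2⟩⟩
      left_inv f := by
        refine Subtype.ext (funext fun i => ?_)
        fin_cases i <;> rfl
      right_inv y := rfl }
  rw [numA, Nat.card_congr e, Nat.card_sigma, sum_coe_sort (antidiagonal n)
    fun x => Nat.card ({ p : Nat.Partition x.1 // IsTCore t p } ×
        { p : Nat.Partition x.2 // IsTCore t p })]
  simp only [Nat.card_prod, numCores]

/-- The generating function of `5`-core partitions. -/
noncomputable def fiveCoreSeries : ℤ⟦X⟧ := mk fun n => (numCores 5 n : ℤ)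

lemma X_pow_dvd_sum_runnerWeight_sub {N R : ℕ} (hN : N ≤ 5 * R) :
    (X : ℤ⟦X⟧) ^ ((5 * R).choose 2 + (N + 1)) ∣
      ∑ v ∈ finsuppAntidiag (univ : Finset (Fin 5)) (5 * R), X ^ runnerWeight v -
        X ^ (5 * R).choose 2 * fiveCoreSeries := by
  rw [X_pow_dvd_iff]
  intro m hm
  rw [map_sub, map_sum, coeff_X_pow_mul', sub_eq_zero]
  simp only [coeff_X_pow, sum_boole]
  split_ifs with h
  · obtain ⟨n, rfl⟩ := Nat.exists_eq_add_of_le' h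
    rw [Nat.add_sub_cancel, fiveCoreSeries, coeff_mk, numCores_five_eq (r := 5 * R) (by lia)]
    simp only [eq_comm]
  · rw [Nat.cast_eq_zero, card_eq_zero, filter_eq_empty_iff]
    intro v hv
    have := runnerWeight_bounds (mem_finsuppAntidiag.1 hv).1 0
    lia

lemma fiveCoreSeries_mul_pentagonalSeries :
    fiveCoreSeries * pentagonalSeries ℤ = qFive (pentagonalSeries ℤ) ^ 5 := by
  rw [← sub_eq_zero]
  ext N
  have h1 := euler_mul_sum_runnerWeight (N := N) (R := 3 * N + 2) le_rfl
  have h2 := (X_pow_dvd_sum_runnerWeight_sub (N := N) (R := 3 * N + 2) (by lia)).mul_left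
    (pentagonalSeries ℤ)
  have h3 := dvd_sub h1 h2
  rw [pow_add] at h3
  have h4 : (X : ℤ⟦X⟧) ^ (N + 1) ∣
      fiveCoreSeries * pentagonalSeries ℤ - qFive (pentagonalSeries ℤ) ^ 5 := by
    refine (mul_dvd_mul_iff_left (pow_ne_zero ((5 * (3 * N + 2)).choose 2) X_ne_zero)).1 ?_
    convert h3 using 1
    ring
  exact X_pow_dvd_iff.1 h4 N (by lia)

theorem stmt_3 : ∀ n : ℕ, 25 ∣ numA 5 2 (25 * n + 23) := by
  intro n
  have h := twentyFive_dvd_coeff_sq fiveCoreSeries_mul_pentagonalSeries n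
  rw [sq, coeff_mul] at h
  simp only [fiveCoreSeries, coeff_mk] at h
  rw [numA_two]
  exact_mod_cast h
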